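/- arXiv:1403.1994 — 2 statements merged into one kernel-verified Lean document; each statement's English description precedes it below -/
import Mathlib

section
/- The family of subspaces (W_A)_{A ∈ P([n])} of L(S_n) is linearly independent (i.e., if f_A ∈ W_A for each A ∈ P([n]) and Σ_{A ∈ P([n])} f_A = 0, then f_A = 0 for every A), and each W_A is contained in L_0(S_n), the subspace of functions f ∈ L(S_n) with Σ_{σ ∈ S_n} f(σ) = 0. -/
open Finset
abbrev InjWord (n : ℕ) := {l : List (Fin n) // l.Nodup}

namespace IncompleteRankings

variable {n : ℕ}

def content (w : InjWord n) : Finset (Fin n) := w.val.toFinset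

def restrict (A : Finset (Fin n)) (w : InjWord n) : InjWord n :=
  ⟨w.val.filter (fun a => a ∈ A), w.prop.filter _⟩

theorem perm_insertIdx {α : Type*} : ∀ (i : ℕ) (a : α) (l : List α), i ≤ l.length →
    List.Perm (l.insertIdx i a) (a :: l)
  | 0, a, l, _ => by simp
  | (i+1), a, [], h => by simp at h
  | (i+1), a, (x :: l), h => by
      rw [List.insertIdx_succ_cons]
      exact ((perm_insertIdx i a l (by simpa using h)).cons x).trans (List.Perm.swap a x l)

theorem nodup_insertIdx {l : List (Fin n)} (hl : l.Nodup) {a : Fin n} (ha : a ∉ l) (i : ℕ) :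
    (l.insertIdx i a).Nodup := by
  rcases le_or_gt i l.length with hi | hi
  · exact ((perm_insertIdx i a l hi).nodup_iff).mpr (List.nodup_cons.mpr ⟨ha, hl⟩)
  · rw [List.insertIdx_of_length_lt hi]; exact hl

def insertAt (w : InjWord n) (i : ℕ) (a : Fin n) : InjWord n :=
  if h : a ∈ w.val then w else ⟨w.val.insertIdx i a, nodup_insertIdx w.prop h i⟩

abbrev FullWord (n : ℕ) := {w : InjWord n // content w = Finset.univ}

/-- The marginal operator `M_A : L(S_n) → L(Γ(A))`. -/
noncomputable def marginal (n : ℕ) (A : Finset (Fin n)) :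
    (FullWord n → ℝ) →ₗ[ℝ] (InjWord n → ℝ) where
  toFun f := fun π => ∑ σ ∈ Finset.univ.filter (fun σ : FullWord n => restrict A σ.val = π), f σ
  map_add' f g := by funext π; simp [Finset.sum_add_distrib]
  map_smul' c f := by funext π; simp [Finset.mul_sum]

/-- The embedding operator `φ_n : L(Γ_n) → L(S_n)`, sending the Dirac function of `π` to the
indicator function of the set of permutations containing `π` as a contiguous subword. -/
noncomputable def phi (n : ℕ) : (InjWord n → ℝ) →ₗ[ℝ] (FullWord n → ℝ) where
  toFun x := fun σ => ∑ π ∈ Finset.univ.filter (fun π : InjWord n => π.val <:+: σ.val.val), x π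
  map_add' x y := by funext σ; simp [Finset.sum_add_distrib]
  map_smul' c x := by funext σ; simp [Finset.mul_sum]

/-- The space `H_A ⊆ L(Γ(A))`. -/
def HSpace (n : ℕ) (A : Finset (Fin n)) : Submodule ℝ (InjWord n → ℝ) where
  carrier := {x | (∀ w : InjWord n, content w ≠ A → x w = 0) ∧
    ∀ a ∈ A, ∀ ω : InjWord n, content ω = A.erase a →
      ∑ i ∈ Finset.range (ω.val.length + 1), x (insertAt ω i a) = 0}
  add_mem' := by
    rintro x y ⟨hx1, hx2⟩ ⟨hy1, hy2⟩
    refine ⟨fun w hw => by simp [hx1 w hw, hy1 w hw], fun a ha ω hω => ?_⟩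
    simp only [Pi.add_apply, Finset.sum_add_distrib, hx2 a ha ω hω, hy2 a ha ω hω, add_zero]
  zero_mem' := ⟨fun _ _ => rfl, fun a ha ω hω => by simp⟩
  smul_mem' := by
    rintro c x ⟨hx1, hx2⟩
    refine ⟨fun w hw => by simp [hx1 w hw], fun a ha ω hω => ?_⟩
    simp only [Pi.smul_apply, smul_eq_mul, ← Finset.mul_sum, hx2 a ha ω hω, mul_zero]

/-- The space `W_A = φ_n(H_A) ⊆ L(S_n)`. -/
noncomputable def WSpace (n : ℕ) (A : Finset (Fin n)) : Submodule ℝ (FullWord n → ℝ) :=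
  (HSpace n A).map (phi n)

/-- The space `V⁰` of constant functions on `S_n`. -/
def V0 (n : ℕ) : Submodule ℝ (FullWord n → ℝ) :=
  Submodule.span ℝ {(fun _ => 1 : FullWord n → ℝ)}


/-- number of full words with infix `π` and restriction `ω` to `B`. -/
def cnt (B : Finset (Fin n)) (ω π : InjWord n) : ℕ :=
  (Finset.univ.filter (fun σ : FullWord n => restrict B σ.val = ω ∧ π.val <:+: σ.val.val)).card

theorem marginal_phi (B : Finset (Fin n)) (x : InjWord n → ℝ) (ω : InjWord n) :
    marginal n B (phi n x) ω = ∑ π, (cnt B ω π : ℝ) * x π := by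
  change (∑ σ ∈ Finset.univ.filter (fun σ : FullWord n => restrict B σ.val = ω),
    ∑ π ∈ Finset.univ.filter (fun π : InjWord n => π.val <:+: σ.val.val), x π) = _
  simp_rw [Finset.sum_filter (fun π : InjWord n => _)]
  rw [Finset.sum_comm]
  refine Finset.sum_congr rfl fun π _ => ?_
  rw [← Finset.sum_filter, Finset.filter_filter, Finset.sum_const, nsmul_eq_mul]
  rfl

/-- the contexts `(u, v)` such that `u ++ π ++ v` is full and restricts to `ω`. -/
def ctx (B : Finset (Fin n)) (ω π : InjWord n) : Finset (InjWord n × InjWord n) :=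
  Finset.univ.filter (fun p => (p.1.val ++ (π.val ++ p.2.val)).Nodup ∧
    (p.1.val ++ (π.val ++ p.2.val)).toFinset = Finset.univ ∧
    (p.1.val ++ (π.val ++ p.2.val)).filter (fun a => a ∈ B) = ω.val)

theorem append_unique {a : Fin n} {u u' t v v' : List (Fin n)}
    (h : (u ++ (a :: t ++ v)).Nodup) (e : u ++ (a :: t ++ v) = u' ++ (a :: t ++ v')) :
    u = u' ∧ v = v' := by
  have h' := h
  rw [e] at h'
  have key : ∀ u v : List (Fin n), (u ++ (a :: t ++ v)).Nodup →
      (u ++ (a :: t ++ v)).idxOf a = u.length := by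
    intro u v h
    have : a ∉ u := by
      intro hu
      have := List.disjoint_of_nodup_append h hu
      simp at this
    rw [List.idxOf_append_of_notMem this]
    simp
  have hl : u.length = u'.length := by rw [← key u v h, ← key u' v' h', e]
  obtain ⟨h1, h2⟩ := List.append_inj e hl
  exact ⟨h1, List.append_cancel_left h2⟩

theorem cnt_eq_ctx (B : Finset (Fin n)) (ω π : InjWord n) (hπ : π.val ≠ []) :
    cnt B ω π = (ctx B ω π).card := by
  symm
  unfold cnt
  refine Finset.card_bij
    (fun p hp => ⟨⟨p.1.val ++ (π.val ++ p.2.val), (Finset.mem_filter.mp hp).2.1⟩,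
      (Finset.mem_filter.mp hp).2.2.1⟩) ?_ ?_ ?_
  · intro p hp
    refine Finset.mem_filter.mpr ⟨Finset.mem_univ _, ?_, ?_⟩
    · exact Subtype.ext (Finset.mem_filter.mp hp).2.2.2
    · exact ⟨p.1.val, p.2.val, by simp⟩
  · intro p hp q hq e
    have e' : p.1.val ++ (π.val ++ p.2.val) = q.1.val ++ (π.val ++ q.2.val) :=
      congrArg (fun z : FullWord n => z.val.val) e
    have hn := (Finset.mem_filter.mp hp).2.1
    obtain ⟨a, t, ht⟩ := List.exists_cons_of_ne_nil hπ
    rw [ht] at e' hn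
    obtain ⟨h1, h2⟩ := append_unique hn e'
    exact Prod.ext (Subtype.ext h1) (Subtype.ext h2)
  · rintro ⟨⟨σ, hσ⟩, hc⟩ h
    obtain ⟨-, h1, u, v, huv⟩ := Finset.mem_filter.mp h
    simp only [List.append_assoc] at huv
    subst huv
    have hu : u.Nodup := hσ.of_append_left
    have hv : v.Nodup := hσ.of_append_right.of_append_right
    exact ⟨⟨⟨u, hu⟩, ⟨v, hv⟩⟩, Finset.mem_filter.mpr ⟨Finset.mem_univ _, hσ, hc,
      congrArg Subtype.val h1⟩, rfl⟩

theorem cnt_congr (B : Finset (Fin n)) (ω π π' : InjWord n) (hπ : π.val ≠ [])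
    (hp : π.val.Perm π'.val)
    (hf : π.val.filter (fun a => a ∈ B) = π'.val.filter (fun a => a ∈ B)) :
    cnt B ω π = cnt B ω π' := by
  have hπ' : π'.val ≠ [] := by
    intro h; rw [h] at hp; exact hπ hp.eq_nil
  rw [cnt_eq_ctx _ _ _ hπ, cnt_eq_ctx _ _ _ hπ']
  congr 1
  unfold ctx
  ext p
  have h1 : (p.1.val ++ (π.val ++ p.2.val)).Perm (p.1.val ++ (π'.val ++ p.2.val)) :=
    (hp.append_right _).append_left _
  simp only [Finset.mem_filter, h1.nodup_iff, List.toFinset_eq_of_perm _ _ h1,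
    List.filter_append, hf]

theorem insertAt_val {ω : InjWord n} {a : Fin n} (ha : a ∉ ω.val) (i : ℕ) :
    (insertAt ω i a).val = ω.val.insertIdx i a := by
  unfold insertAt; rw [dif_neg ha]

theorem insertIdx_split (s t : List (Fin n)) (a : Fin n) :
    (s ++ t).insertIdx s.length a = s ++ a :: t := by
  induction s with
  | nil => simp
  | cons b s ih => simp [ih]

theorem exists_split (l : List (Fin n)) (i : ℕ) (hi : i ≤ l.length) :
    ∃ s t, l = s ++ t ∧ s.length = i :=
  ⟨l.take i, l.drop i, by simp, by simp [hi]⟩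

theorem sum_fiber (A : Finset (Fin n)) (a : Fin n) (ha : a ∈ A) (ω : InjWord n)
    (hω : content ω = A.erase a) (g : InjWord n → ℝ) :
    ∑ π ∈ Finset.univ.filter (fun π : InjWord n => content π = A ∧ restrict (A.erase a) π = ω),
      g π = ∑ i ∈ Finset.range (ω.val.length + 1), g (insertAt ω i a) := by
  have hmem : ∀ b, b ∈ ω.val ↔ b ≠ a ∧ b ∈ A := by
    intro b
    have : b ∈ content ω ↔ b ∈ A.erase a := by rw [hω]
    simpa [content] using this
  have haω : a ∉ ω.val := by simp [hmem]
  symm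
  refine Finset.sum_bij (fun i _ => insertAt ω i a) ?_ ?_ ?_ (fun _ _ => rfl)
  · intro i hi
    obtain ⟨s, t, hst, rfl⟩ := exists_split ω.val i (by simpa [Nat.lt_succ_iff] using hi)
    have hv : (insertAt ω s.length a).val = s ++ a :: t := by
      rw [insertAt_val haω, hst, insertIdx_split]
    refine Finset.mem_filter.mpr ⟨Finset.mem_univ _, ?_, ?_⟩
    · ext b
      have := hmem b
      rw [hst] at this
      simp only [content, hv, List.mem_toFinset, List.mem_append, List.mem_cons] at this ⊢
      by_cases hb : b = a
      · subst hb; simp [ha]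
      · simp [hb] at this ⊢; exact this
    · apply Subtype.ext
      simp only [restrict, hv]
      have : ∀ b ∈ s ++ t, b ∈ A.erase a := by
        intro b hb
        rw [← hst, hmem] at hb
        simpa using hb
      rw [hst, List.filter_append, List.filter_cons_of_neg (by simp), ← List.filter_append]
      exact List.filter_eq_self.mpr (by simpa using this)
  · intro i hi j hj e
    have key : ∀ i ∈ Finset.range (ω.val.length + 1), (insertAt ω i a).val.idxOf a = i := by
      intro i hi
      obtain ⟨s, t, hst, rfl⟩ := exists_split ω.val i (by simpa [Nat.lt_succ_iff] using hi)
      rw [insertAt_val haω]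
      rw [hst] at haω ⊢
      rw [insertIdx_split, List.idxOf_append_of_notMem (fun h => haω (List.mem_append_left _ h))]
      simp
    rw [← key i hi, ← key j hj]
    exact congrArg (fun z : InjWord n => z.val.idxOf a) e
  · intro π hπ
    obtain ⟨-, hc, hr⟩ := Finset.mem_filter.mp hπ
    have hcm : ∀ b, b ∈ π.val ↔ b ∈ A := by
      intro b; rw [← hc]; simp [content]
    obtain ⟨s, t, hst⟩ := List.append_of_mem ((hcm a).mpr ha)
    have hnd := π.prop
    have hωv : ω.val = s ++ t := by
      rw [← hr]
      simp only [restrict]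
      rw [hst, List.filter_append, List.filter_cons_of_neg (by simp), ← List.filter_append]
      apply List.filter_eq_self.mpr
      intro b hb
      have hbA : b ∈ A := by
        rw [← hcm, hst]; simp at hb ⊢; tauto
      have hba : b ≠ a := by
        rintro rfl
        rw [hst, List.nodup_middle] at hnd
        exact (List.nodup_cons.mp hnd).1 hb
      simp [hba, hbA]
    refine ⟨s.length, by simp [hωv], ?_⟩
    apply Subtype.ext
    rw [insertAt_val haω, hωv, insertIdx_split, hst]

theorem marginal_zero {A B : Finset (Fin n)} (hAB : ¬ A ⊆ B) {x : InjWord n → ℝ}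
    (hx : x ∈ HSpace n A) (ω : InjWord n) : marginal n B (phi n x) ω = 0 := by
  obtain ⟨hx1, hx2⟩ := hx
  obtain ⟨a, ha, haB⟩ := Finset.not_subset.mp hAB
  rw [marginal_phi]
  have h0 : ∑ π, (cnt B ω π : ℝ) * x π =
      ∑ π ∈ Finset.univ.filter (fun π : InjWord n => content π = A), (cnt B ω π : ℝ) * x π := by
    symm
    refine Finset.sum_filter_of_ne fun π _ h => ?_
    by_contra hc
    exact h (by rw [hx1 π hc, mul_zero])
  rw [h0, ← Finset.sum_fiberwise _ (fun π : InjWord n => restrict (A.erase a) π)]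
  refine Finset.sum_eq_zero fun τ _ => ?_
  rw [Finset.filter_filter]
  by_cases hτ : content τ = A.erase a
  · have haτ : a ∉ τ.val := by
      have : a ∉ content τ := by simp [hτ]
      simpa [content] using this
    rw [sum_fiber A a ha τ hτ]
    have hk : ∀ i ∈ Finset.range (τ.val.length + 1),
        (cnt B ω (insertAt τ i a) : ℝ) * x (insertAt τ i a) =
        (cnt B ω (insertAt τ 0 a) : ℝ) * x (insertAt τ i a) := by
      intro i hi
      have hi' : i ≤ τ.val.length := by simpa [Nat.lt_succ_iff] using hi
      have hp : (insertAt τ i a).val.Perm (insertAt τ 0 a).val := by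
        rw [insertAt_val haτ, insertAt_val haτ]
        simpa using perm_insertIdx i a τ.val hi'
      rw [cnt_congr B ω (insertAt τ i a) (insertAt τ 0 a) ?_ hp ?_]
      · intro h
        rw [h] at hp
        have := hp.symm.eq_nil
        rw [insertAt_val haτ] at this
        simp at this
      · obtain ⟨s, t, hst, rfl⟩ := exists_split τ.val i hi'
        rw [insertAt_val haτ, insertAt_val haτ, hst, insertIdx_split]
        simp [haB]
    rw [Finset.sum_congr rfl hk, ← Finset.mul_sum, hx2 a ha τ hτ, mul_zero]
  · rw [Finset.filter_eq_empty_iff.mpr, Finset.sum_empty]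
    rintro π - ⟨hc, hr⟩
    apply hτ
    rw [← hr]
    ext b
    have : b ∈ content π ↔ b ∈ A := by rw [hc]
    simp only [content, List.mem_toFinset] at this
    simp only [content, restrict, List.mem_toFinset, List.mem_filter, this]
    simp

theorem cnt_self_pos (A : Finset (Fin n)) (π : InjWord n) (hπ : content π = A) :
    0 < cnt A π π := by
  unfold cnt
  have hm : ∀ b, b ∈ π.val ↔ b ∈ A := by
    intro b; rw [← hπ]; simp [content]
  have hnd : (π.val ++ (Aᶜ).toList).Nodup := by
    refine List.Nodup.append π.prop (Finset.nodup_toList _) ?_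
    intro b hb hb'
    simp at hb'
    exact hb' ((hm b).mp hb)
  refine Finset.card_pos.mpr ⟨⟨⟨π.val ++ (Aᶜ).toList, hnd⟩, ?_⟩, ?_⟩
  · ext b
    simp only [content, List.mem_toFinset, List.mem_append, hm, Finset.mem_toList]
    simp [em]
  · refine Finset.mem_filter.mpr ⟨Finset.mem_univ _, ?_, [], (Aᶜ).toList, by simp⟩
    apply Subtype.ext
    simp only [restrict, List.filter_append]
    rw [List.filter_eq_self.mpr (by intro b hb; simpa using (hm b).mp hb),
      List.filter_eq_nil_iff.mpr (by intro b hb; simpa using hb), List.append_nil]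

theorem cnt_ne (A : Finset (Fin n)) (ω π : InjWord n) (hπ : content π = A) (hne : π ≠ ω) :
    cnt A ω π = 0 := by
  unfold cnt
  rw [Finset.card_eq_zero, Finset.filter_eq_empty_iff]
  rintro ⟨⟨σ, hσ⟩, hc⟩ - ⟨hr, u, v, huv⟩
  apply hne
  rw [← hr]
  simp only at huv
  subst huv
  have hm : ∀ b, b ∈ π.val ↔ b ∈ A := by
    intro b; rw [← hπ]; simp [content]
  have hd1 := List.disjoint_of_nodup_append hσ.of_append_left
  have hd2 := List.disjoint_of_nodup_append hσ
  apply Subtype.ext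
  simp only [restrict, List.filter_append]
  have e1 : π.val.filter (fun a => a ∈ A) = π.val :=
    List.filter_eq_self.mpr (by intro b hb; simpa using (hm b).mp hb)
  have e2 : u.filter (fun a => a ∈ A) = [] := by
    refine List.filter_eq_nil_iff.mpr ?_
    intro b hb hbA
    exact hd1 hb ((hm b).mpr (by simpa using hbA))
  have e3 : v.filter (fun a => a ∈ A) = [] := by
    refine List.filter_eq_nil_iff.mpr ?_
    intro b hb hbA
    exact hd2 (List.mem_append_right _ ((hm b).mpr (by simpa using hbA))) hb
  rw [e1, e2, e3]
  simp

theorem marginal_self {A : Finset (Fin n)} {x : InjWord n → ℝ}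
    (hx : x ∈ HSpace n A) (ω : InjWord n) :
    marginal n A (phi n x) ω = (cnt A ω ω : ℝ) * x ω := by
  rw [marginal_phi]
  refine Finset.sum_eq_single ω (fun π _ hne => ?_) (fun h => absurd (Finset.mem_univ _) h)
  by_cases hc : content π = A
  · rw [cnt_ne A ω π hc hne]; simp
  · rw [hx.1 π hc, mul_zero]

theorem eq_zero_of_marginal {A : Finset (Fin n)} {f : FullWord n → ℝ} (hf : f ∈ WSpace n A)
    (h : marginal n A f = 0) : f = 0 := by
  obtain ⟨x, hx, rfl⟩ := hf
  have : x = 0 := by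
    funext ω
    by_cases hc : content ω = A
    · have h1 := congrFun h ω
      rw [marginal_self hx] at h1
      have h2 := cnt_self_pos A ω hc
      rcases mul_eq_zero.mp h1 with h3 | h3
      · exact absurd (Nat.cast_eq_zero.mp h3) h2.ne'
      · exact h3
    · exact hx.1 ω hc
  rw [this, map_zero]

theorem marginal_zero' {A B : Finset (Fin n)} (hAB : ¬ A ⊆ B) {f : FullWord n → ℝ}
    (hf : f ∈ WSpace n A) : marginal n B f = 0 := by
  obtain ⟨x, hx, rfl⟩ := hf
  funext ω
  exact marginal_zero hAB hx ω

/-- The family `(W_A)_{A ∈ P([n])}` is linearly independent, and each `W_A`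
is contained in `L_0(S_n) = {f : Σ_σ f(σ) = 0}`. -/
theorem statement7 (n : ℕ) :
    (∀ f : Finset (Fin n) → (FullWord n → ℝ),
      (∀ A : Finset (Fin n), 2 ≤ A.card → f A ∈ WSpace n A) →
      (∑ A ∈ Finset.univ.filter (fun A : Finset (Fin n) => 2 ≤ A.card), f A) = 0 →
      ∀ A : Finset (Fin n), 2 ≤ A.card → f A = 0) ∧
    (∀ A : Finset (Fin n), 2 ≤ A.card → ∀ g ∈ WSpace n A, ∑ σ : FullWord n, g σ = 0) := by
  constructor
  · intro f hf hs A
    induction A using Finset.strongInduction with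
    | H A ih =>
      intro hA
      apply eq_zero_of_marginal (hf A hA)
      have h := congrArg (marginal n A) hs
      rw [map_zero, map_sum, Finset.sum_eq_single A] at h
      · exact h
      · intro A' hA' hne
        have hc := (Finset.mem_filter.mp hA').2
        by_cases hsub : A' ⊆ A
        · rw [ih A' (hsub.ssubset_of_ne hne) hc, map_zero]
        · exact marginal_zero' hsub (hf A' hc)
      · intro hn
        exact (hn (Finset.mem_filter.mpr ⟨Finset.mem_univ _, hA⟩)).elim
  · intro A hA g hg
    have hsub : ¬ A ⊆ ∅ := by
      intro h
      rw [Finset.subset_empty.mp h] at hA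
      simp at hA
    have h := congrFun (marginal_zero' hsub hg) ⟨[], List.nodup_nil⟩
    have h2 : ∑ σ ∈ Finset.univ.filter (fun σ : FullWord n =>
        restrict ∅ σ.val = ⟨[], List.nodup_nil⟩), g σ = 0 := h
    rwa [Finset.filter_true_of_mem] at h2
    intro σ _
    apply Subtype.ext
    simp [restrict]

end IncompleteRankings
end

section
/- Let A ⊆ [n] be nonempty and let π ∈ Γ_n be a nonempty word with c(π) ⊆ A. Then M_A(φ_n δ_π) = ((n−|π|+1)!/(|A|−|π|+1)!) · φ_A δ_π, where δ_π is the Dirac function of π. Equivalently, for every ρ ∈ Γ(A), the number of permutations σ ∈ S_n with σ|A = ρ and containing π as a contiguous subword equals (n−|π|+1)!/(|A|−|π|+1)! if π is a contiguous subword of ρ, and 0 otherwise. -/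
open Finset

namespace IncompleteRankings

variable {n : ℕ}

theorem infix_pos_unique {α : Type*} [DecidableEq α] {s p t s' t' : List α} (hp : p ≠ [])
    (hn : (s ++ p ++ t).Nodup) (h : s ++ p ++ t = s' ++ p ++ t') : s.length = s'.length := by
  obtain ⟨a, q, rfl⟩ := List.exists_cons_of_ne_nil hp
  have hn' := hn
  rw [h] at hn'
  have h1 : a ∉ s := by
    intro ha
    simp [List.nodup_append] at hn
    grind
  have h2 : a ∉ s' := by
    intro ha
    simp [List.nodup_append] at hn'
    grind
  have e1 : (s ++ a :: q ++ t).idxOf a = s.length := by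
    simp [List.idxOf_append, h1]
  have e2 : (s' ++ a :: q ++ t').idxOf a = s'.length := by
    simp [List.idxOf_append, h2]
  rw [← e1, ← e2, h]

theorem infix_split {α : Type*} {p x y : List α} {b : α} (hb : b ∉ p)
    (h : p <:+: x ++ b :: y) : p <:+: x ∨ p <:+: y := by
  obtain ⟨s, t, h⟩ := h
  rw [List.append_assoc, List.append_eq_append_iff] at h
  rcases h with ⟨a, rfl, h⟩ | ⟨c, rfl, h⟩
  · rw [List.append_eq_append_iff] at h
    rcases h with ⟨a', rfl, h⟩ | ⟨c, rfl, h⟩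
    · left; exact ⟨s, a', by simp⟩
    · rcases c with _ | ⟨d, c⟩
      · left; exact ⟨s, [], by simp⟩
      · simp at h
        exact absurd (by simp [h.1]) hb
  · rcases c with _ | ⟨d, c⟩
    · rcases p with _ | ⟨d, p⟩
      · left; exact List.nil_infix
      · simp at h
        exact absurd (by simp [h.1]) hb
    · simp at h
      right; exact ⟨c, t, by simp [h.2]⟩

theorem infix_filter (A : Finset (Fin n)) (π : InjWord n) (hsub : content π ⊆ A) (w : InjWord n)
    (h : π.val <:+: w.val) : π.val <:+: (restrict A w).val := by
  have h1 := h.filter (fun a => decide (a ∈ A))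
  have h2 : π.val.filter (fun a => decide (a ∈ A)) = π.val := by
    rw [List.filter_eq_self]
    intro a ha
    simpa using hsub (by simpa [content] using ha)
  rw [h2] at h1
  exact h1

theorem content_restrict (A : Finset (Fin n)) (w : InjWord n) :
    content (restrict A w) = content w ∩ A := by
  ext a; simp [content, restrict]

theorem length_eq_card (w : InjWord n) : w.val.length = (content w).card := by
  rw [content, List.toFinset_card_of_nodup w.prop]

theorem count_insert (A : Finset (Fin n)) (π ρ : InjWord n) (hπ : π.val ≠ [])
    (b : Fin n) (hb : b ∉ A) (hρ : content ρ = A) (hi : π.val <:+: ρ.val) :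
    (Finset.univ.filter (fun w : InjWord n => content w = insert b A ∧ restrict A w = ρ ∧
      π.val <:+: w.val)).card = A.card - π.val.length + 2 := by
  obtain ⟨s, t, hst⟩ := hi
  have hbρ : b ∉ ρ.val := by
    intro h; apply hb; rw [← hρ]; simpa [content] using h
  have hmem : ∀ a, a ∈ ρ.val ↔ a ∈ A := by
    intro a; rw [← hρ]; simp [content]
  have hbπ : b ∉ π.val := by
    intro h; apply hbρ; rw [← hst]; simp [h]
  have hlen : A.card = s.length + π.val.length + t.length := by
    rw [← hρ, ← length_eq_card, ← hst]; simp [add_assoc]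
  have hpos : 0 < π.val.length := List.length_pos_iff.mpr hπ
  have hρl : ρ.val.length = A.card := by rw [length_eq_card, hρ]
  have hnd : (s ++ π.val ++ t).Nodup := hst ▸ ρ.prop
  let K := Finset.range (s.length + 1) ∪ Finset.Ico (s.length + π.val.length) (A.card + 1)
  let h : ℕ → List (Fin n) := fun k => ρ.val.take k ++ b :: ρ.val.drop k
  have hK : K.card = A.card - π.val.length + 2 := by
    rw [Finset.card_union_of_disjoint]
    · simp; omega
    · rw [Finset.disjoint_left]; intro x; simp; omega
  have hidx : ∀ k ∈ K, (h k).idxOf b = k := by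
    intro k hk
    have hk' : k ≤ ρ.val.length := by
      simp [K] at hk; omega
    have : b ∉ ρ.val.take k := fun hh => hbρ (List.mem_of_mem_take hh)
    simp [h, List.idxOf_append, this, hk']
  have himg : (Finset.univ.filter (fun w : InjWord n => content w = insert b A ∧
      restrict A w = ρ ∧ π.val <:+: w.val)).image Subtype.val = K.image h := by
    ext l
    simp only [Finset.mem_image, Finset.mem_filter, Finset.mem_univ, true_and]
    constructor
    · rintro ⟨w, ⟨hc, hr, hinf⟩, rfl⟩
      have hbw : b ∈ w.val := by
        have : b ∈ content w := by rw [hc]; simp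
        simpa [content] using this
      obtain ⟨x, y, hxy⟩ := List.append_of_mem hbw
      have hwn := w.prop
      rw [hxy] at hwn
      have hAw : ∀ a, a ∈ w.val ↔ a = b ∨ a ∈ A := by
        intro a
        have : a ∈ content w ↔ a = b ∨ a ∈ A := by rw [hc]; simp
        simpa [content] using this
      have hbx : b ∉ x ∧ b ∉ y := by
        simp [List.nodup_append] at hwn
        grind
      have hxA : ∀ a ∈ x, a ∈ A := by
        intro a ha
        have := (hAw a).1 (by rw [hxy]; simp [ha])
        rcases this with rfl | h
        · exact absurd ha hbx.1
        · exact h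
      have hyA : ∀ a ∈ y, a ∈ A := by
        intro a ha
        have := (hAw a).1 (by rw [hxy]; simp [ha])
        rcases this with rfl | h
        · exact absurd ha hbx.2
        · exact h
      have hρxy : ρ.val = x ++ y := by
        rw [← hr]
        simp only [restrict, hxy, List.filter_append]
        rw [List.filter_cons_of_neg (by simpa using hb), List.filter_eq_self.2 (by simpa using hxA),
          List.filter_eq_self.2 (by simpa using hyA)]
      refine ⟨x.length, ?_, ?_⟩
      · have hl2 : A.card = x.length + y.length := by rw [← hρl, hρxy]; simp
        rw [hxy] at hinf
        simp only [K, Finset.mem_union, Finset.mem_range, Finset.mem_Ico]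
        rcases infix_split hbπ hinf with ⟨s', t', h'⟩ | ⟨s', t', h'⟩
        · have := infix_pos_unique (s' := s') (t' := t' ++ y) hπ hnd
            (by rw [hst, hρxy, ← h']; simp)
          have h3 : x.length = s'.length + π.val.length + t'.length := by rw [← h']; simp [add_assoc]
          omega
        · have := infix_pos_unique (s' := x ++ s') (t' := t') hπ hnd
            (by rw [hst, hρxy, ← h']; simp)
          simp at this
          omega
      · simp [h, hρxy, hxy]
    · rintro ⟨k, hk, rfl⟩
      have hperm : (h k).Perm (b :: ρ.val) := by
        have := (List.perm_middle (a := b) (l₁ := ρ.val.take k) (l₂ := ρ.val.drop k))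
        rwa [List.take_append_drop] at this
      have hn2 : (h k).Nodup := hperm.nodup_iff.2 (List.nodup_cons.2 ⟨hbρ, ρ.prop⟩)
      refine ⟨⟨h k, hn2⟩, ⟨?_, ?_, ?_⟩, rfl⟩
      · ext a
        simp [content, hperm.mem_iff, hmem]
      · apply Subtype.ext
        simp only [restrict, h, List.filter_append]
        rw [List.filter_cons_of_neg (by simpa using hb), ← List.filter_append,
          List.take_append_drop, List.filter_eq_self]
        intro a ha
        simpa using (hmem a).1 ha
      · simp only [K, Finset.mem_union, Finset.mem_range, Finset.mem_Ico] at hk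
        simp only [h]
        rcases hk with hk | hk
        · have : π.val <:+: ρ.val.drop k := by
            refine ⟨s.drop k, t, ?_⟩
            rw [← hst, List.append_assoc, List.append_assoc, List.drop_append_of_le_length (by omega)]
          exact this.trans ⟨ρ.val.take k ++ [b], [], by simp⟩
        · have : π.val <:+: ρ.val.take k := by
            refine ⟨s, t.take (k - (s ++ π.val).length), ?_⟩
            rw [← hst, List.take_append, List.take_of_length_le (l := s ++ π.val) (by simp; omega)]
          exact this.trans ⟨[], b :: ρ.val.drop k, by simp⟩
  rw [← Finset.card_image_of_injective _ Subtype.val_injective, himg, Finset.card_image_of_injOn, hK]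
  intro i hi j hj hij
  rw [← hidx i hi, ← hidx j hj, hij]

theorem restrict_restrict {A B : Finset (Fin n)} (h : A ⊆ B) (w : InjWord n) :
    restrict A (restrict B w) = restrict A w := by
  apply Subtype.ext
  simp only [restrict, List.filter_filter]
  apply List.filter_congr
  intro a _
  by_cases ha : a ∈ A
  · simp [ha, h ha]
  · simp [ha]

theorem count_full (π : InjWord n) (hπ : π.val ≠ []) (m : ℕ) :
    ∀ (A : Finset (Fin n)) (ρ : InjWord n), A.card + m = n → content π ⊆ A → content ρ = A →
      π.val <:+: ρ.val →
      (Finset.univ.filter (fun σ : FullWord n => restrict A σ.val = ρ ∧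
        π.val <:+: σ.val.val)).card * (A.card - π.val.length + 1).factorial =
        (n - π.val.length + 1).factorial := by
  induction m with
  | zero =>
    intro A ρ hA hs hρ hi
    have hAu : A = Finset.univ := by
      rw [← Finset.card_eq_iff_eq_univ]; simpa using hA
    have : (Finset.univ.filter (fun σ : FullWord n => restrict A σ.val = ρ ∧
        π.val <:+: σ.val.val)) = {⟨ρ, by rw [hρ, hAu]⟩} := by
      have hr : ∀ w : InjWord n, restrict A w = w := by
        intro w; apply Subtype.ext; simp [restrict, hAu]
      ext σ
      simp only [Finset.mem_filter, Finset.mem_univ, true_and, Finset.mem_singleton, hr]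
      constructor
      · rintro ⟨h, _⟩; exact Subtype.ext h
      · rintro rfl; exact ⟨rfl, hi⟩
    rw [this]
    simp at hA
    simp [hA]
  | succ m ih =>
    intro A ρ hA hs hρ hi
    have hp : π.val.length ≤ A.card := by
      rw [length_eq_card]; exact Finset.card_le_card hs
    obtain ⟨b, hb⟩ : ∃ b, b ∉ A := by
      by_contra hcon
      push Not at hcon
      have : A = Finset.univ := by ext; simp [hcon]
      rw [this] at hA; simp at hA
    have hcard : (insert b A).card = A.card + 1 := Finset.card_insert_of_notMem hb
    have hAB : A ⊆ insert b A := Finset.subset_insert b A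
    set F := (Finset.univ.filter (fun w : InjWord n => content w = insert b A ∧ restrict A w = ρ ∧
      π.val <:+: w.val)) with hF
    have hFc : F.card = A.card - π.val.length + 2 := count_insert A π ρ hπ b hb hρ hi
    rw [Finset.card_eq_sum_card_fiberwise (f := fun σ : FullWord n => restrict (insert b A) σ.val)
      (t := F)]
    · have hfib : ∀ w ∈ F, (Finset.filter (fun σ : FullWord n => restrict (insert b A) σ.val = w)
          (Finset.univ.filter (fun σ : FullWord n => restrict A σ.val = ρ ∧
        π.val <:+: σ.val.val))).card * (A.card + 1 - π.val.length + 1).factorial =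
          (n - π.val.length + 1).factorial := by
        intro w hw
        simp only [hF, Finset.mem_filter, Finset.mem_univ, true_and] at hw
        rw [← ih (insert b A) w (by omega) (hs.trans hAB) hw.1 hw.2.2, hcard]
        congr 2
        ext σ
        simp only [Finset.mem_filter, Finset.mem_univ, true_and]
        constructor
        · rintro ⟨⟨h1, h2⟩, h3⟩; exact ⟨h3, h2⟩
        · rintro ⟨h1, h2⟩
          exact ⟨⟨by rw [← restrict_restrict hAB, h1, hw.2.1], h2⟩, h1⟩
      have hsum := Finset.sum_congr rfl hfib
      rw [← Finset.sum_mul, Finset.sum_const, hFc, smul_eq_mul] at hsum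
      have e : A.card + 1 - π.val.length + 1 = (A.card - π.val.length + 1) + 1 := by omega
      rw [e, Nat.factorial_succ] at hsum
      have : 0 < A.card - π.val.length + 2 := by omega
      apply Nat.eq_of_mul_eq_mul_left this
      rw [← hsum]; ring
    · intro σ hσ
      simp only [Finset.coe_filter, Finset.mem_univ, true_and, Set.mem_setOf_eq, hF] at hσ ⊢
      refine ⟨?_, ?_, ?_⟩
      · rw [content_restrict, σ.prop, Finset.univ_inter]
      · rw [restrict_restrict hAB, hσ.1]
      · exact infix_filter _ π (hs.trans hAB) _ hσ.2

/-- For nonempty `A ⊆ [n]` and a nonempty word `π` with `c(π) ⊆ A`: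
`M_A(φ_n δ_π) = ((n−|π|+1)!/(|A|−|π|+1)!) · φ_A δ_π`, where `φ_A δ_π` is the indicator
function of `Γ_A[π] = {ρ ∈ Γ(A) : π is a contiguous subword of ρ}`. -/
theorem statement16 (n : ℕ) (A : Finset (Fin n)) (hA : A.Nonempty) (π : InjWord n)
    (hπ : π.val ≠ []) (hsub : content π ⊆ A) :
    marginal n A (phi n (fun w => if w = π then 1 else 0)) =
      ((Nat.factorial (n - π.val.length + 1) : ℝ) /
          (Nat.factorial (A.card - π.val.length + 1) : ℝ)) •
        (fun ρ : InjWord n => if content ρ = A ∧ π.val <:+: ρ.val then (1 : ℝ) else 0) := by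
  funext ρ
  have hL : marginal n A (phi n (fun w => if w = π then 1 else 0)) ρ =
      ((Finset.univ.filter (fun σ : FullWord n => restrict A σ.val = ρ ∧
        π.val <:+: σ.val.val)).card : ℝ) := by
    simp only [marginal, phi, LinearMap.coe_mk, AddHom.coe_mk]
    rw [← Finset.filter_filter, Finset.card_filter]
    push_cast
    apply Finset.sum_congr rfl
    intro σ _
    rw [Finset.sum_ite_eq']
    simp
  rw [hL, Pi.smul_apply, smul_eq_mul]
  by_cases hc : content ρ = A ∧ π.val <:+: ρ.val
  · rw [if_pos hc, mul_one, eq_div_iff (by positivity)]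
    have hle : A.card ≤ n := by simpa using Finset.card_le_univ A
    exact_mod_cast count_full π hπ (n - A.card) A ρ (by omega) hsub hc.1 hc.2
  · rw [if_neg hc, mul_zero, Nat.cast_eq_zero, Finset.card_eq_zero, Finset.filter_eq_empty_iff]
    rintro σ - ⟨h1, h2⟩
    apply hc
    rw [← h1]
    exact ⟨by rw [content_restrict, σ.prop, Finset.univ_inter], infix_filter A π hsub _ h2⟩

end IncompleteRankings
end
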